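/- Let ρ be a d×d density matrix whose eigenvalues λ_0,…,λ_{d−1} are pairwise distinct, with orthonormal eigenbasis ψ_0,…,ψ_{d−1}, let D be a Lindblad dissipator built from matrices L_1,…,L_m, and let γ > 0. Then ρ is stabilizable with respect to D if and only if for every k ∈ {1,…,d−1} the 'dissipative flux' condition Σ_{j=0}^{d−1} λ_j · Tr( ψ_k ψ_k† · D(ψ_j ψ_j†) ) = 0 holds. -/

import Mathlib

open Matrix
open scoped ComplexOrder

/-- The dissipator with Lindblad operators `L`, as a linear map. -/
noncomputable def lindbladDissipator {n ι : Type*} [Fintype n] [Fintype ι]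
    (L : ι → Matrix n n ℂ) : Matrix n n ℂ →ₗ[ℂ] Matrix n n ℂ where
  toFun M := ∑ j, (L j * M * (L j)ᴴ
      - (1/2 : ℂ) • ((L j)ᴴ * L j * M + M * ((L j)ᴴ * L j)))
  map_add' M N := by
    rw [← Finset.sum_add_distrib]
    refine Finset.sum_congr rfl fun j _ => ?_
    simp only [mul_add, add_mul, smul_add]
    abel
  map_smul' c M := by
    simp only [RingHom.id_apply, Finset.smul_sum]
    refine Finset.sum_congr rfl fun j _ => ?_
    simp only [Matrix.mul_smul, Matrix.smul_mul, smul_sub, smul_add, smul_comm c (1/2 : ℂ)]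

section

variable {n ι : Type*} [Fintype n] [Fintype ι]

theorem lindbladDissipator_apply (L : ι → Matrix n n ℂ) (M : Matrix n n ℂ) :
    lindbladDissipator L M = ∑ j, (L j * M * (L j)ᴴ
      - (1/2 : ℂ) • ((L j)ᴴ * L j * M + M * ((L j)ᴴ * L j))) :=
  rfl

theorem trace_lindbladDissipator (L : ι → Matrix n n ℂ) (M : Matrix n n ℂ) :
    (lindbladDissipator L M).trace = 0 := by
  rw [lindbladDissipator_apply, trace_sum]
  refine Finset.sum_eq_zero fun j _ => ?_
  rw [trace_sub, trace_smul, trace_add, trace_mul_comm M, trace_mul_cycle, smul_eq_mul]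
  ring

theorem isHermitian_lindbladDissipator (L : ι → Matrix n n ℂ) {M : Matrix n n ℂ}
    (hM : M.IsHermitian) : (lindbladDissipator L M).IsHermitian := by
  rw [lindbladDissipator_apply, Matrix.IsHermitian, conjTranspose_sum]
  refine Finset.sum_congr rfl fun j _ => ?_
  simp [conjTranspose_mul, hM.eq, mul_assoc, add_comm]

/-- A Hermitian matrix is a multiple of a commutator with a diagonal matrix with simple spectrum
exactly when its diagonal vanishes. -/
theorem exists_isHermitian_commutator_diagonal_iff [DecidableEq n] {lam : n → ℝ}
    (hlam : Function.Injective lam) {γ : ℝ} (hγ : γ ≠ 0) {E : Matrix n n ℂ}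
    (hE : E.IsHermitian) :
    (∃ K : Matrix n n ℂ, K.IsHermitian ∧
      (-Complex.I) • (K * diagonal (fun l => (lam l : ℂ)) - diagonal (fun l => (lam l : ℂ)) * K)
        + (γ : ℂ) • E = 0) ↔ ∀ k, E k k = 0 := by
  constructor
  · rintro ⟨K, -, h⟩ k
    have hk := congrFun (congrFun h k) k
    simpa [mul_comm, hγ] using hk
  · intro h
    refine ⟨of fun k l => -Complex.I * γ * E k l / (lam l - lam k), ?_, ?_⟩
    · ext k l
      have hkl : star (E l k) = E k l := hE.apply k l
      simp only [conjTranspose_apply, of_apply, star_div₀, star_mul', star_neg, star_sub, hkl]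
      simp only [Complex.star_def, Complex.conj_I, Complex.conj_ofReal, neg_neg]
      rw [← neg_sub (lam l : ℂ) (lam k : ℂ), div_neg]
      ring
    · ext k l
      rcases eq_or_ne k l with rfl | hkl
      · simp [h]
      · have hne : (lam l : ℂ) - lam k ≠ 0 := by
          rw [sub_ne_zero]
          exact_mod_cast fun e => hkl (hlam e).symm
        simp only [Matrix.add_apply, Matrix.smul_apply, Matrix.sub_apply, mul_diagonal, diagonal_mul, of_apply,
          smul_eq_mul, Matrix.zero_apply]
        field_simp
        linear_combination (γ * E k l * (lam l - lam k) : ℂ) * Complex.I_sq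

theorem conjTranspose_mul_mul_apply_eq_trace (v : n → n → ℂ) (X : Matrix n n ℂ) (k : n) :
    ((of v)ᵀᴴ * X * (of v)ᵀ) k k = (vecMulVec (v k) (star (v k)) * X).trace := by
  rw [vecMulVec_mul, trace_vecMulVec, dotProduct_comm, Matrix.mul_apply]
  rfl

end

theorem stmt_3 {d m : ℕ}
    (ρ : Matrix (Fin d) (Fin d) ℂ)
    (hPSD : ρ.PosSemidef) (hTr : ρ.trace = 1)
    (ψ : Fin d → (Fin d → ℂ)) (lam : Fin d → ℝ)
    (hDistinct : Function.Injective lam)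
    (hON : ∀ l l', star (ψ l) ⬝ᵥ ψ l' = if l = l' then 1 else 0)
    (hEig : ∀ l, ρ *ᵥ ψ l = (lam l : ℂ) • ψ l)
    (L : Fin m → Matrix (Fin d) (Fin d) ℂ)
    (D : Matrix (Fin d) (Fin d) ℂ → Matrix (Fin d) (Fin d) ℂ)
    (hD : ∀ M, D M = ∑ j, (L j * M * (L j)ᴴ
      - (1/2 : ℂ) • ((L j)ᴴ * L j * M + M * ((L j)ᴴ * L j))))
    (γ : ℝ) (hγ : 0 < γ) :
    (∃ H : Matrix (Fin d) (Fin d) ℂ, H.IsHermitian ∧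
        (-Complex.I) • (H * ρ - ρ * H) + (γ : ℂ) • D ρ = 0) ↔
    (∀ k : Fin d, (k : ℕ) ≠ 0 →
      ∑ j, (lam j : ℂ) *
        (Matrix.vecMulVec (ψ k) (star (ψ k)) *
          D (Matrix.vecMulVec (ψ j) (star (ψ j)))).trace = 0) := by
  have hDL : ∀ M, D M = lindbladDissipator L M := hD
  set U : Matrix (Fin d) (Fin d) ℂ := (of ψ)ᵀ with hU
  set Λ : Matrix (Fin d) (Fin d) ℂ := diagonal fun l => (lam l : ℂ) with hΛ
  have hUU : Uᴴ * U = 1 := by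
    ext k l
    rw [one_apply, ← hON]
    rfl
  have hUU' : U * Uᴴ = 1 := mul_eq_one_comm.mp hUU
  have hρU : ρ * U = U * Λ := by
    ext i l
    rw [hΛ, mul_diagonal, mul_comm]
    exact congrFun (hEig l) i
  have hUρ : Uᴴ * ρ = Λ * Uᴴ := by
    calc Uᴴ * ρ = Uᴴ * (ρ * U) * Uᴴ := by rw [mul_assoc, mul_assoc, hUU', mul_one]
      _ = Λ * Uᴴ := by rw [hρU, ← mul_assoc, hUU, one_mul]
  have hρ : ρ = ∑ j, (lam j : ℂ) • vecMulVec (ψ j) (star (ψ j)) := by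
    calc ρ = U * Λ * Uᴴ := by rw [← hρU, mul_assoc, hUU', mul_one]
      _ = _ := by
        ext a b
        rw [Matrix.mul_apply, Matrix.sum_apply]
        refine Finset.sum_congr rfl fun j _ => ?_
        rw [hΛ, mul_diagonal, Matrix.smul_apply, vecMulVec_apply, smul_eq_mul]
        simp only [hU, transpose_apply, conjTranspose_apply, of_apply, Pi.star_apply]
        ring
  set E := Uᴴ * D ρ * U with hEdef
  have hE : E.IsHermitian :=
    isHermitian_conjTranspose_mul_mul U (hDL ρ ▸ isHermitian_lindbladDissipator L hPSD.1)
  have hflux : ∀ k, ∑ j, (lam j : ℂ) * (vecMulVec (ψ k) (star (ψ k)) *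
      D (vecMulVec (ψ j) (star (ψ j)))).trace = E k k := by
    intro k
    rw [hEdef, hU, conjTranspose_mul_mul_apply_eq_trace]
    conv_rhs => rw [hρ, hDL, map_sum, Finset.mul_sum, trace_sum]
    refine Finset.sum_congr rfl fun j _ => ?_
    rw [map_smul, Matrix.mul_smul, trace_smul, smul_eq_mul, hDL]
  have hEtr : E.trace = 0 := by
    rw [hEdef, trace_mul_cycle, hUU', one_mul, hDL, trace_lindbladDissipator]
  have hdiag : (∀ k : Fin d, (k : ℕ) ≠ 0 → E k k = 0) ↔ ∀ k, E k k = 0 := by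
    refine ⟨fun h k => ?_, fun h k _ => h k⟩
    by_cases hk : (k : ℕ) = 0
    · rw [← hEtr, trace, Finset.sum_eq_single k]
      · rfl
      · exact fun l _ hl => h l fun h0 => hl (Fin.ext (h0.trans hk.symm))
      · simp
    · exact h k hk
  simp only [hflux]
  rw [hdiag, ← exists_isHermitian_commutator_diagonal_iff hDistinct hγ.ne' hE]
  constructor
  · rintro ⟨H, hH, h⟩
    refine ⟨Uᴴ * H * U, isHermitian_conjTranspose_mul_mul U hH, ?_⟩
    have key : Uᴴ * ((-Complex.I) • (H * ρ - ρ * H) + (γ : ℂ) • D ρ) * U = 0 := by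
      rw [h, mul_zero, zero_mul]
    have h1 : Uᴴ * (H * ρ) * U = Uᴴ * H * U * Λ := by
      simp only [mul_assoc, hρU]
    have h2 : Uᴴ * (ρ * H) * U = Λ * (Uᴴ * H * U) := by
      simp only [← mul_assoc, hUρ]
    simpa only [mul_add, add_mul, mul_sub, sub_mul, Matrix.mul_smul, Matrix.smul_mul, h1, h2]
      using key
  · rintro ⟨K, hK, h⟩
    refine ⟨U * K * Uᴴ, isHermitian_mul_mul_conjTranspose U hK, ?_⟩
    have key : U * ((-Complex.I) • (K * Λ - Λ * K) + (γ : ℂ) • E) * Uᴴ = 0 := by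
      rw [h, mul_zero, zero_mul]
    have h1 : U * (K * Λ) * Uᴴ = U * K * Uᴴ * ρ := by
      simp only [mul_assoc, hUρ]
    have h2 : U * (Λ * K) * Uᴴ = ρ * (U * K * Uᴴ) := by
      simp only [← mul_assoc, hρU]
    have h3 : U * E * Uᴴ = D ρ := by
      rw [hEdef, ← mul_assoc, ← mul_assoc, hUU', one_mul, mul_assoc, hUU', mul_one]
    simpa only [mul_add, add_mul, mul_sub, sub_mul, Matrix.mul_smul, Matrix.smul_mul, h1, h2, h3]
      using key
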